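/- Let H be an associative unital k-algebra, V and W k-vector spaces with distinguished elements 1_V and 1_W, and let R: V⊗H → H⊗V (R(v⊗h) = h_R⊗v_R), σ: V⊗V → H⊗V (σ(v⊗v') = σ₁(v,v')⊗σ₂(v,v')), P: H⊗W → W⊗H (P(h⊗w) = w_P⊗h_P), ν: W⊗W → W⊗H (ν(w⊗w') = ν₁(w,w')⊗ν₂(w,w')) and Q: V⊗W → W⊗H⊗V (Q(v⊗w) = Q_W(v,w)⊗Q_H(v,w)⊗Q_V(v,w)) be arbitrary linear maps. Set U = W⊗V with 1_U = 1_W⊗1_V and define J(h⊗(w⊗v)) = (w_P⊗v)⊗h_P, T((w⊗v)⊗h) = (w⊗v_R)⊗h_R, γ((w⊗v)⊗(w'⊗v')) = (w⊗Q_V(v,w'))⊗(Q_W(v,w')⊗v')⊗Q_H(v,w'), and η((w⊗v)⊗(w'⊗v')) = (ν₁(w,w')⊗σ₂(v,v'))⊗ν₂(w,w')⊗σ₁(v,v'). Then the L-R-crossed product multiplication formula on (W⊗V)⊗H built from these maps evaluates, for all w, w' ∈ W, v, v' ∈ V, h, h' ∈ H, to ((w⊗v)⊗h)((w'⊗v')⊗h')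 = (ν₁(w,Q_W(v,w')_P) ⊗ σ₂(Q_V(v,w')_R,v')) ⊗ ν₂(w,Q_W(v,w')_P) h_P Q_H(v,w') h'_R σ₁(Q_V(v,w')_R,v'), where P is applied to h⊗Q_W(v,w') and R to Q_V(v,w')⊗h'; under the canonical linear isomorphism W⊗V⊗H ≅ W⊗H⊗V this is exactly the multiplication of the iterated crossed product on W⊗H⊗V. -/

import Mathlib

open TensorProduct LinearMap

noncomputable section

variable {k : Type*} [Field k]

section Helpers

variable {M N P Q : Type*}
  [AddCommMonoid M] [AddCommMonoid N] [AddCommMonoid P] [AddCommMonoid Q]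
  [Module k M] [Module k N] [Module k P] [Module k Q]

def aso : (M ⊗[k] N) ⊗[k] P →ₗ[k] M ⊗[k] (N ⊗[k] P) :=
  (TensorProduct.assoc k M N P).toLinearMap

def osa : M ⊗[k] (N ⊗[k] P) →ₗ[k] (M ⊗[k] N) ⊗[k] P :=
  (TensorProduct.assoc k M N P).symm.toLinearMap

def cc : M ⊗[k] N →ₗ[k] N ⊗[k] M := (TensorProduct.comm k M N).toLinearMap

def lc : M ⊗[k] (N ⊗[k] P) →ₗ[k] N ⊗[k] (M ⊗[k] P) :=
  (TensorProduct.leftComm k M N P).toLinearMap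

def tt : (M ⊗[k] N) ⊗[k] (P ⊗[k] Q) →ₗ[k] (M ⊗[k] P) ⊗[k] (N ⊗[k] Q) :=
  (TensorProduct.tensorTensorTensorComm k M N P Q).toLinearMap

end Helpers

section LRCrossed

variable (k)
variable (H U : Type*) [Ring H] [Algebra k H] [AddCommGroup U] [Module k U]

abbrev mH : H ⊗[k] H →ₗ[k] H := LinearMap.mul' k H

def dR : (H ⊗[k] H) ⊗[k] H →ₗ[k] H ⊗[k] H :=
  rTensor H (mH k H) ∘ₗ osa ∘ₗ lTensor H cc ∘ₗ aso

/-- `d ⊗ (g ⊗ i) ↦ (d*g) ⊗ i`. -/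
def dL : H ⊗[k] (H ⊗[k] H) →ₗ[k] H ⊗[k] H :=
  rTensor H (mH k H) ∘ₗ osa

/-- `(g ⊗ i) ⊗ d ↦ g ⊗ (d*i)`. -/
def eR : (H ⊗[k] H) ⊗[k] H →ₗ[k] H ⊗[k] H :=
  lTensor H ((mH k H) ∘ₗ cc) ∘ₗ aso

/-- `d ⊗ (g ⊗ i) ↦ g ⊗ (i*d)`. -/
def eL : H ⊗[k] (H ⊗[k] H) →ₗ[k] H ⊗[k] H :=
  lTensor H ((mH k H) ∘ₗ cc) ∘ₗ lc

/-- `(g ⊗ i) ⊗ (a ⊗ b) ↦ (g*a) ⊗ (b*i)`. -/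
def mulLR : (H ⊗[k] H) ⊗[k] (H ⊗[k] H) →ₗ[k] H ⊗[k] H :=
  TensorProduct.map (mH k H) ((mH k H) ∘ₗ cc) ∘ₗ tt


def w12 : H ⊗[k] (H ⊗[k] H) →ₗ[k] H ⊗[k] H :=
  lTensor H ((mH k H) ∘ₗ cc) ∘ₗ lc ∘ₗ lTensor H cc

def inner12 : (H ⊗[k] H) ⊗[k] (H ⊗[k] H) →ₗ[k] H ⊗[k] H :=
  lTensor H ((mH k H) ∘ₗ cc) ∘ₗ aso ∘ₗ lTensor (H ⊗[k] H) ((mH k H) ∘ₗ cc)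

/-- `(g ⊗ i) ⊗ (b ⊗ (d ⊗ e)) ↦ g * d * e * b * i`. -/
def omegaM : (H ⊗[k] H) ⊗[k] (H ⊗[k] (H ⊗[k] H)) →ₗ[k] H :=
  (mH k H) ∘ₗ
    TensorProduct.map (mH k H) ((mH k H) ∘ₗ rTensor H (mH k H) ∘ₗ cc) ∘ₗ
    tt ∘ₗ lTensor (H ⊗[k] H) (lTensor H cc ∘ₗ lc)

variable {H U}
variable (J : H ⊗[k] U →ₗ[k] U ⊗[k] H) (T : U ⊗[k] H →ₗ[k] U ⊗[k] H)
variable (γ : U ⊗[k] U →ₗ[k] U ⊗[k] (U ⊗[k] H))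
variable (η : U ⊗[k] U →ₗ[k] U ⊗[k] (H ⊗[k] H))

variable (oneU : U)

/-- Axiom (1): `J(h ⊗ 1_U) = 1_U ⊗ h` and `J(1_H ⊗ u) = u ⊗ 1_H`. -/
def LRax1 : Prop :=
  (∀ h : H, J (h ⊗ₜ oneU) = oneU ⊗ₜ h) ∧ (∀ u : U, J ((1 : H) ⊗ₜ u) = u ⊗ₜ (1 : H))

/-- Axiom (2): `T(u ⊗ 1_H) = u ⊗ 1_H` and `T(1_U ⊗ h) = 1_U ⊗ h`. -/
def LRax2 : Prop :=
  (∀ u : U, T (u ⊗ₜ (1 : H)) = u ⊗ₜ (1 : H)) ∧ (∀ h : H, T (oneU ⊗ₜ h) = oneU ⊗ₜ h)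

/-- Axiom (3): `γ(u ⊗ 1_U) = u ⊗ 1_U ⊗ 1_H` and `γ(1_U ⊗ u) = 1_U ⊗ u ⊗ 1_H`. -/
def LRax3 : Prop :=
  (∀ u : U, γ (u ⊗ₜ oneU) = u ⊗ₜ (oneU ⊗ₜ (1 : H))) ∧
  (∀ u : U, γ (oneU ⊗ₜ u) = oneU ⊗ₜ (u ⊗ₜ (1 : H)))

/-- Axiom (4): `η(u ⊗ 1_U) = η(1_U ⊗ u) = u ⊗ 1_H ⊗ 1_H`. -/
def LRax4 : Prop :=
  (∀ u : U, η (u ⊗ₜ oneU) = u ⊗ₜ ((1 : H) ⊗ₜ (1 : H))) ∧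
  (∀ u : U, η (oneU ⊗ₜ u) = u ⊗ₜ ((1 : H) ⊗ₜ (1 : H)))

/-- Axiom (5): `u_J ⊗ (hh')_J = (u_J)_j ⊗ h_j h'_J`. -/
def LRax5 : Prop := ∀ (h h' : H) (u : U),
  J ((h * h') ⊗ₜ u) =
    lTensor U (mH k H) (aso (rTensor H J (osa (h ⊗ₜ (J (h' ⊗ₜ u))))))

/-- Axiom (6): `u_T ⊗ (hh')_T = (u_T)_t ⊗ h_T h'_t`. -/
def LRax6 : Prop := ∀ (u : U) (h h' : H),
  T (u ⊗ₜ (h * h')) =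
    lTensor U ((mH k H) ∘ₗ cc)
      (aso (rTensor H T (osa (lTensor U cc (aso ((T (u ⊗ₜ h)) ⊗ₜ h'))))))

/-- Axiom (7):
`η₁(u_J,u'_j) ⊗ η₂(u_J,u'_j)(h_J)_j ⊗ η₃(u_J,u'_j) = η₁(u,u')_J ⊗ h_J η₂(u,u') ⊗ η₃(u,u')`. -/
def LRax7 : Prop := ∀ (h : H) (u u' : U),
  lTensor U (dR k H)
      (aso (rTensor H η (osa (lTensor U J (aso ((J (h ⊗ₜ u)) ⊗ₜ u'))))))
  = lTensor U (dL k H)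
      (aso (rTensor (H ⊗[k] H) J (osa (h ⊗ₜ (η (u ⊗ₜ u'))))))

/-- Axiom (8):
`η₁(u_t,u'_T) ⊗ η₂(u_t,u'_T) ⊗ (h_T)_t η₃(u_t,u'_T) = η₁(u,u')_T ⊗ η₂(u,u') ⊗ η₃(u,u')h_T`. -/
def LRax8 : Prop := ∀ (u u' : U) (h : H),
  lTensor U (eR k H)
      (aso (rTensor H η (osa (lTensor U cc
        (aso (rTensor U T (osa (lTensor U cc (u ⊗ₜ (T (u' ⊗ₜ h)))))))))))
  = lTensor U (eL k H)
      (aso (rTensor (H ⊗[k] H) T (osa (lTensor U cc (aso ((η (u ⊗ₜ u')) ⊗ₜ h))))))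

/-- Axiom (9). -/
def LRax9 : Prop := ∀ (u u' u'' : U),
  lTensor U (mulLR k H)
      (aso (rTensor (H ⊗[k] H) η (osa (lTensor U (aso (P := H))
        ((lTensor U (rTensor H J ∘ₗ osa ∘ₗ lTensor H cc ∘ₗ aso))
          (aso ((η (u ⊗ₜ u')) ⊗ₜ u'')))))))
  = lTensor U ((mulLR k H) ∘ₗ lTensor (H ⊗[k] H) cc)
      (aso (rTensor (H ⊗[k] H) η (tt (rTensor (U ⊗[k] H) T
        (osa (lTensor U (lc ∘ₗ lTensor U cc) (u ⊗ₜ (η (u' ⊗ₜ u'')))))))))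


def qJ : (U ⊗[k] H) ⊗[k] H →ₗ[k] U ⊗[k] H :=
  lTensor U (mH k H) ∘ₗ aso ∘ₗ rTensor H J ∘ₗ osa ∘ₗ lc ∘ₗ lTensor U cc ∘ₗ aso

/-- Axiom (10). -/
def LRax10 : Prop := ∀ (u u' : U) (h : H),
  lTensor U (lTensor U ((mH k H) ∘ₗ cc))
      (aso (tt (rTensor (U ⊗[k] H) T (osa (lTensor U cc
        (aso (rTensor H γ (osa (u ⊗ₜ (J (h ⊗ₜ u')))))))))))
  = lTensor U (qJ k J)
      (aso (rTensor H γ (osa (lTensor U cc (aso ((T (u ⊗ₜ h)) ⊗ₜ u'))))))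

def psi11 : (U ⊗[k] H) ⊗[k] (H ⊗[k] H) →ₗ[k] U ⊗[k] (H ⊗[k] H) :=
  lTensor U (rTensor H (mH k H) ∘ₗ osa) ∘ₗ aso

def chainX : (U ⊗[k] H) ⊗[k] (U ⊗[k] H) →ₗ[k] U ⊗[k] (H ⊗[k] H) :=
  (lTensor U ((dR k H) ∘ₗ lTensor (H ⊗[k] H) (mH k H))) ∘ₗ aso ∘ₗ
    rTensor (H ⊗[k] H) η ∘ₗ rTensor (H ⊗[k] H) cc ∘ₗ tt ∘ₗ
    lTensor (U ⊗[k] H) cc ∘ₗ rTensor (H ⊗[k] U) J ∘ₗ rTensor (H ⊗[k] U) cc ∘ₗ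
    tt ∘ₗ lTensor (U ⊗[k] H) cc

/-- Axiom (11). -/
def LRax11 : Prop := ∀ (u u' u'' : U),
  lTensor U (psi11 k)
      (aso (tt (rTensor ((U ⊗[k] H) ⊗[k] H) T (tt (rTensor (H ⊗[k] H) γ
        (osa (u ⊗ₜ (η (u' ⊗ₜ u'')))))))))
  = lTensor U (chainX k J η)
      (aso (rTensor (U ⊗[k] H) γ (osa (lTensor U cc
        (aso ((γ (u ⊗ₜ u')) ⊗ₜ u''))))))

def chain12 : (U ⊗[k] H) ⊗[k] (H ⊗[k] H) →ₗ[k] U ⊗[k] (H ⊗[k] H) :=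
  (lTensor U (w12 k H)) ∘ₗ aso ∘ₗ tt ∘ₗ rTensor (H ⊗[k] H) J ∘ₗ
    rTensor (H ⊗[k] H) cc ∘ₗ tt ∘ₗ lTensor (U ⊗[k] H) cc

def big12 : (H ⊗[k] H) ⊗[k] (H ⊗[k] (U ⊗[k] H)) →ₗ[k] U ⊗[k] (H ⊗[k] H) :=
  lTensor U (inner12 k H) ∘ₗ lc ∘ₗ lTensor (H ⊗[k] H) lc

/-- Axiom (12). -/
def LRax12 : Prop := ∀ (u u' u'' : U),
  lTensor U (chain12 k J)
      (aso (rTensor (H ⊗[k] H) γ (osa (lTensor U cc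
        (aso ((η (u ⊗ₜ u')) ⊗ₜ u''))))))
  = lTensor U (big12 k)
      (aso (rTensor (H ⊗[k] (U ⊗[k] H)) η (tt (lTensor (U ⊗[k] H) cc
        (rTensor ((U ⊗[k] H) ⊗[k] U) T (tt (lTensor (U ⊗[k] (U ⊗[k] H)) cc
          (rTensor (U ⊗[k] H) γ (osa (lTensor U lc (u ⊗ₜ (γ (u' ⊗ₜ u'')))))))))))))

def w13 : H ⊗[k] (U ⊗[k] H) →ₗ[k] U ⊗[k] H :=
  lTensor U ((mH k H) ∘ₗ cc) ∘ₗ lc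

def xi2 : H ⊗[k] (U ⊗[k] H) →ₗ[k] U ⊗[k] H :=
  lTensor U (mH k H) ∘ₗ aso ∘ₗ rTensor H J ∘ₗ osa

def xi : H ⊗[k] (U ⊗[k] (U ⊗[k] H)) →ₗ[k] U ⊗[k] (U ⊗[k] H) :=
  lTensor U (xi2 k J) ∘ₗ lc

def rho : (U ⊗[k] H) ⊗[k] U →ₗ[k] (U ⊗[k] (U ⊗[k] H)) ⊗[k] H :=
  rTensor H γ ∘ₗ osa ∘ₗ lTensor U cc ∘ₗ aso

def chainR : ((U ⊗[k] (U ⊗[k] H)) ⊗[k] H) ⊗[k] H →ₗ[k] (U ⊗[k] H) ⊗[k] (U ⊗[k] H) :=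
  tt ∘ₗ lTensor (U ⊗[k] U) cc ∘ₗ
    lTensor (U ⊗[k] U) (rTensor H ((mH k H) ∘ₗ cc) ∘ₗ osa) ∘ₗ tt ∘ₗ
    lTensor (U ⊗[k] H) aso ∘ₗ rTensor ((U ⊗[k] H) ⊗[k] H) T ∘ₗ tt ∘ₗ
    lTensor (U ⊗[k] (U ⊗[k] H)) cc ∘ₗ aso

/-- The composite computing the right-hand side of axiom (13). -/
def rhs13 : ((H ⊗[k] (U ⊗[k] U)) ⊗[k] U) ⊗[k] H →ₗ[k]
    (U ⊗[k] (U ⊗[k] H)) ⊗[k] (U ⊗[k] H) :=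
  osa ∘ₗ lTensor U (chainR k T) ∘ₗ aso ∘ₗ
    rTensor H (lTensor U (rho k γ) ∘ₗ aso ∘ₗ rTensor U ((xi k J) ∘ₗ lTensor H γ))

/-- Axiom (13). -/
def LRax13 : Prop := ∀ (u u' u'' : U) (h h' : H),
  rTensor (U ⊗[k] H) (xi k J)
      (osa (h' ⊗ₜ (lTensor (U ⊗[k] (U ⊗[k] H)) (w13 k)
        (aso (rTensor (U ⊗[k] H) (rTensor H γ) (rTensor (U ⊗[k] H) osa
          (osa (u ⊗ₜ (rTensor (U ⊗[k] H) T (osa (lTensor U cc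
            (aso ((γ (u' ⊗ₜ u'')) ⊗ₜ h)))))))))))))
  = rhs13 k J T γ (((h' ⊗ₜ (u ⊗ₜ u')) ⊗ₜ u'') ⊗ₜ h)

/-- The L-R-crossed product multiplication, as a linear map. -/
def lrM : (U ⊗[k] H) ⊗[k] (U ⊗[k] H) →ₗ[k] U ⊗[k] H :=
  lTensor U (omegaM k H) ∘ₗ aso ∘ₗ rTensor (H ⊗[k] (H ⊗[k] H)) η ∘ₗ tt ∘ₗ
    lTensor (U ⊗[k] H) aso ∘ₗ rTensor ((U ⊗[k] H) ⊗[k] H) T ∘ₗ tt ∘ₗ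
    lTensor (U ⊗[k] (U ⊗[k] H)) cc ∘ₗ
    rTensor (H ⊗[k] H) (lTensor U J ∘ₗ lTensor U cc ∘ₗ aso) ∘ₗ tt ∘ₗ
    rTensor (H ⊗[k] H) (osa ∘ₗ γ) ∘ₗ tt

/-- The L-R-crossed product multiplication of two elements of `U ⊗ H`. -/
def lrMul (x y : U ⊗[k] H) : U ⊗[k] H := lrM k J T γ η (x ⊗ₜ y)

end LRCrossed


section Iterated

variable {k : Type*} [Field k]
variable {H V W : Type*} [Ring H] [Algebra k H]
  [AddCommGroup V] [Module k V] [AddCommGroup W] [Module k W]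

variable (R : V ⊗[k] H →ₗ[k] H ⊗[k] V) (σ : V ⊗[k] V →ₗ[k] H ⊗[k] V)
variable (P : H ⊗[k] W →ₗ[k] W ⊗[k] H) (ν : W ⊗[k] W →ₗ[k] W ⊗[k] H)
variable (Q : V ⊗[k] W →ₗ[k] W ⊗[k] (H ⊗[k] V))

/-- `J(h ⊗ (w ⊗ v)) = (w_P ⊗ v) ⊗ h_P`, with `P` applied to `h ⊗ w`. -/
def iterJ : H ⊗[k] (W ⊗[k] V) →ₗ[k] (W ⊗[k] V) ⊗[k] H :=
  osa ∘ₗ lTensor W cc ∘ₗ aso ∘ₗ rTensor V P ∘ₗ osa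

/-- `T((w ⊗ v) ⊗ h) = (w ⊗ v_R) ⊗ h_R`, with `R` applied to `v ⊗ h`. -/
def iterT : (W ⊗[k] V) ⊗[k] H →ₗ[k] (W ⊗[k] V) ⊗[k] H :=
  osa ∘ₗ lTensor W cc ∘ₗ lTensor W R ∘ₗ aso

/-- `γ((w⊗v) ⊗ (w'⊗v')) = (w ⊗ Q_V(v,w')) ⊗ ((Q_W(v,w') ⊗ v') ⊗ Q_H(v,w'))`. -/
def iterγ : (W ⊗[k] V) ⊗[k] (W ⊗[k] V) →ₗ[k]
    (W ⊗[k] V) ⊗[k] ((W ⊗[k] V) ⊗[k] H) :=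
  osa ∘ₗ
    lTensor W ((lTensor V osa ∘ₗ lc ∘ₗ
        lTensor W (lTensor V cc ∘ₗ lc ∘ₗ aso) ∘ₗ aso) ∘ₗ
      rTensor V Q ∘ₗ osa) ∘ₗ
    aso

/-- `η((w⊗v) ⊗ (w'⊗v')) = (ν₁(w,w') ⊗ σ₂(v,v')) ⊗ (ν₂(w,w') ⊗ σ₁(v,v'))`. -/
def iterη : (W ⊗[k] V) ⊗[k] (W ⊗[k] V) →ₗ[k] (W ⊗[k] V) ⊗[k] (H ⊗[k] H) :=
  tt ∘ₗ lTensor (W ⊗[k] H) cc ∘ₗ TensorProduct.map ν σ ∘ₗ tt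

end Iterated

section Iterated2

variable {k : Type*} [Field k]
variable {H V W : Type*} [Ring H] [Algebra k H]
  [AddCommGroup V] [Module k V] [AddCommGroup W] [Module k W]

/-- Multiplying five factors `n₂ ⊗ (h_P ⊗ (Q_H ⊗ (h'_R ⊗ (σ₁ ⊗ σ₂))))` into
`σ₂ ⊗ (n₂ h_P Q_H h'_R σ₁)`. -/
def iterX : H ⊗[k] (H ⊗[k] (H ⊗[k] (H ⊗[k] (H ⊗[k] V)))) →ₗ[k] V ⊗[k] H :=
  lTensor V ((LinearMap.mul' k H) ∘ₗ lTensor H ((LinearMap.mul' k H) ∘ₗ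
      lTensor H ((LinearMap.mul' k H) ∘ₗ lTensor H (LinearMap.mul' k H)))) ∘ₗ
    lc ∘ₗ lTensor H lc ∘ₗ lTensor H (lTensor H lc) ∘ₗ
    lTensor H (lTensor H (lTensor H lc)) ∘ₗ
    lTensor H (lTensor H (lTensor H (lTensor H cc)))

/-- The multiplication of the iterated crossed product `W ⊗ H ⊗ V` (written on
`(W ⊗ V) ⊗ H`):
`((w⊗v)⊗h)((w'⊗v')⊗h') = (ν₁(w,Q_W(v,w')_P) ⊗ σ₂(Q_V(v,w')_R,v')) ⊗
  ν₂(w,Q_W(v,w')_P) h_P Q_H(v,w') h'_R σ₁(Q_V(v,w')_R,v')`. -/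
def iterRHS (R : V ⊗[k] H →ₗ[k] H ⊗[k] V) (σ : V ⊗[k] V →ₗ[k] H ⊗[k] V)
    (P : H ⊗[k] W →ₗ[k] W ⊗[k] H) (ν : W ⊗[k] W →ₗ[k] W ⊗[k] H)
    (Q : V ⊗[k] W →ₗ[k] W ⊗[k] (H ⊗[k] V))
    (w : W) (v : V) (h : H) (w' : W) (v' : V) (h' : H) : (W ⊗[k] V) ⊗[k] H :=
  osa (lTensor W (iterX (k := k))
    (aso (aso (lTensor ((W ⊗[k] H) ⊗[k] H) (lTensor H (lTensor H
        (σ ∘ₗ ((TensorProduct.mk k V V).flip v'))))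
      (rTensor (H ⊗[k] (H ⊗[k] V)) (rTensor H (ν ∘ₗ (TensorProduct.mk k W W) w))
        (lTensor (W ⊗[k] H) (lTensor H R ∘ₗ aso)
          (aso ((rTensor (H ⊗[k] V) P (osa (h ⊗ₜ (Q (v ⊗ₜ w'))))) ⊗ₜ h'))))))))

end Iterated2


section PureTensors

variable {M N P Q : Type*}
  [AddCommMonoid M] [AddCommMonoid N] [AddCommMonoid P] [AddCommMonoid Q]
  [Module k M] [Module k N] [Module k P] [Module k Q]

lemma aso_tmul (m : M) (n : N) (p : P) :
    aso (k := k) ((m ⊗ₜ n) ⊗ₜ p) = m ⊗ₜ (n ⊗ₜ p) := rfl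

lemma osa_tmul (m : M) (n : N) (p : P) :
    osa (k := k) (m ⊗ₜ (n ⊗ₜ p)) = (m ⊗ₜ n) ⊗ₜ p := rfl

lemma cc_tmul (m : M) (n : N) : cc (k := k) (m ⊗ₜ n) = n ⊗ₜ m := rfl

lemma lc_tmul (m : M) (n : N) (p : P) :
    lc (k := k) (m ⊗ₜ (n ⊗ₜ p)) = n ⊗ₜ (m ⊗ₜ p) := rfl

lemma tt_tmul (m : M) (n : N) (p : P) (q : Q) :
    tt (k := k) ((m ⊗ₜ n) ⊗ₜ (p ⊗ₜ q)) = (m ⊗ₜ p) ⊗ₜ (n ⊗ₜ q) := rfl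

end PureTensors

/-- For arbitrary linear maps `R`, `σ`, `P`, `ν`, `Q` as above, the
L-R-crossed product multiplication formula on `(W ⊗ V) ⊗ H` built from the maps `J`, `T`,
`γ`, `η` of the iterated construction evaluates to
`((w⊗v)⊗h)((w'⊗v')⊗h') = (ν₁(w,Q_W(v,w')_P) ⊗ σ₂(Q_V(v,w')_R,v')) ⊗
  ν₂(w,Q_W(v,w')_P) h_P Q_H(v,w') h'_R σ₁(Q_V(v,w')_R,v')`,
which (under the canonical linear isomorphism `W ⊗ V ⊗ H ≅ W ⊗ H ⊗ V`) is exactly the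
multiplication of the iterated crossed product on `W ⊗ H ⊗ V`. -/
theorem lr_crossed_product_eq_iterated_crossed_product_mul
    {k : Type*} [Field k] {H V W : Type*} [Ring H] [Algebra k H]
    [AddCommGroup V] [Module k V] [AddCommGroup W] [Module k W]
    (R : V ⊗[k] H →ₗ[k] H ⊗[k] V) (σ : V ⊗[k] V →ₗ[k] H ⊗[k] V)
    (P : H ⊗[k] W →ₗ[k] W ⊗[k] H) (ν : W ⊗[k] W →ₗ[k] W ⊗[k] H)
    (Q : V ⊗[k] W →ₗ[k] W ⊗[k] (H ⊗[k] V)) :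
    ∀ (w w' : W) (v v' : V) (h h' : H),
      lrMul k (iterJ P) (iterT R) (iterγ Q) (iterη σ ν)
          ((w ⊗ₜ v) ⊗ₜ h) ((w' ⊗ₜ v') ⊗ₜ h') =
        iterRHS R σ P ν Q w v h w' v' h' := by
  intro w w' v v' h h'
  simp only [lrMul, lrM, iterJ, iterT, iterγ, iterη, iterRHS, iterX, omegaM,
    aso_tmul, osa_tmul, tt_tmul, comp_apply,
    lTensor_tmul, rTensor_tmul]
  induction Q (v ⊗ₜ w') using TensorProduct.induction_on with
  | zero => simp only [map_zero, zero_tmul, tmul_zero]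
  | add x y hx hy => simp only [map_add, add_tmul, tmul_add, hx, hy]
  | tmul a q =>
  induction q using TensorProduct.induction_on with
  | zero => simp only [map_zero, zero_tmul, tmul_zero]
  | add x y hx hy => simp only [map_add, add_tmul, tmul_add, hx, hy]
  | tmul b c =>
  simp only [aso_tmul, osa_tmul, cc_tmul, lc_tmul, tt_tmul, comp_apply,
    lTensor_tmul, rTensor_tmul]
  induction P (h ⊗ₜ a) using TensorProduct.induction_on with
  | zero => simp only [map_zero, zero_tmul, tmul_zero]
  | add x y hx hy => simp only [map_add, add_tmul, tmul_add, hx, hy]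
  | tmul a' hP =>
  simp only [aso_tmul, osa_tmul, cc_tmul, comp_apply,
    lTensor_tmul, rTensor_tmul]
  induction R (c ⊗ₜ h') using TensorProduct.induction_on with
  | zero => simp only [map_zero, zero_tmul, tmul_zero]
  | add x y hx hy => simp only [map_add, add_tmul, tmul_add, hx, hy]
  | tmul hR c' =>
  simp only [osa_tmul, cc_tmul, tt_tmul, comp_apply,
    lTensor_tmul, rTensor_tmul, TensorProduct.map_tmul, mk_apply, flip_apply]
  induction ν (w ⊗ₜ a') using TensorProduct.induction_on with
  | zero => simp only [map_zero, zero_tmul]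
  | add x y hx hy => simp only [map_add, add_tmul, hx, hy]
  | tmul n₁ n₂ =>
  induction σ (c' ⊗ₜ v') using TensorProduct.induction_on with
  | zero => simp only [map_zero, zero_tmul, tmul_zero]
  | add x y hx hy => simp only [map_add, add_tmul, tmul_add, hx, hy]
  | tmul s₁ s₂ =>
  simp only [aso_tmul, osa_tmul, cc_tmul, lc_tmul, tt_tmul, comp_apply,
    lTensor_tmul, rTensor_tmul, TensorProduct.map_tmul, mul'_apply, mul_assoc]
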